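/- For random variables Y₀, B, Y (with B = (B₁,…,B_{N_B}) independent of Y₀, and the B_i mutually independent), and for any disjoint subsets J₁, J₂ ⊆ [N_B]: I(B_{J₁}; Y | Y₀, B_{J₃}) ≤ I(B_{J₁}; Y | B_{J₂}, Y₀, B_{J₃}) whenever J₁, J₂, J₃ are pairwise disjoint. That is, conditioning on additional independent shared-randomness components cannot decrease the conditional mutual information with B_{J₁}. -/

import Mathlib

open scoped Classical in
/-- Probability that the random variable `X` takes value `s`, under the (finite) probability
mass function `p` on the sample space `Ω`. -/
noncomputable def pmfOf {Ω S : Type*} [Fintype Ω] (p : Ω → ℝ) (X : Ω → S) (s : S) : ℝ :=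
  ∑ ω : Ω, if X ω = s then p ω else 0

/-- Shannon entropy (in nats) of the random variable `X` under `p`. -/
noncomputable def Hent {Ω S : Type*} [Fintype Ω] [Fintype S] (p : Ω → ℝ) (X : Ω → S) : ℝ :=
  -∑ s : S, pmfOf p X s * Real.log (pmfOf p X s)

/-- Conditional entropy `H(X | Z)`. -/
noncomputable def condH {Ω S U : Type*} [Fintype Ω] [Fintype S] [Fintype U]
    (p : Ω → ℝ) (X : Ω → S) (Z : Ω → U) : ℝ :=
  Hent p (fun ω => (X ω, Z ω)) - Hent p Z

/-- Mutual information `I(X ; Y)`. -/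
noncomputable def MI {Ω S T : Type*} [Fintype Ω] [Fintype S] [Fintype T]
    (p : Ω → ℝ) (X : Ω → S) (Y : Ω → T) : ℝ :=
  Hent p X + Hent p Y - Hent p (fun ω => (X ω, Y ω))

/-- Conditional mutual information `I(X ; Y | Z)`. -/
noncomputable def CMI {Ω S T U : Type*} [Fintype Ω] [Fintype S] [Fintype T] [Fintype U]
    (p : Ω → ℝ) (X : Ω → S) (Y : Ω → T) (Z : Ω → U) : ℝ :=
  Hent p (fun ω => (X ω, Z ω)) + Hent p (fun ω => (Y ω, Z ω))
    - Hent p (fun ω => (X ω, Y ω, Z ω)) - Hent p Z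

theorem sum_pmfOf_mul {Ω S : Type*} [Fintype Ω] [Fintype S] (p : Ω → ℝ) (X : Ω → S)
    (F : S → ℝ) : ∑ s, pmfOf p X s * F s = ∑ ω, p ω * F (X ω) := by
  classical
  simp only [pmfOf, Finset.sum_mul, ite_mul, zero_mul]
  rw [Finset.sum_comm]
  refine Finset.sum_congr rfl fun ω _ => ?_
  rw [Finset.sum_eq_single (X ω)]
  · simp
  · intro s _ hs
    rw [if_neg (Ne.symm hs)]
  · simp

theorem pmfOf_nonneg {Ω S : Type*} [Fintype Ω] {p : Ω → ℝ} (hp : ∀ ω, 0 ≤ p ω) (X : Ω → S)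
    (s : S) : 0 ≤ pmfOf p X s :=
  Finset.sum_nonneg fun ω _ => by split_ifs <;> simp [hp]

theorem pmfOf_apply_pos {Ω S : Type*} [Fintype Ω] {p : Ω → ℝ} (hp : ∀ ω, 0 ≤ p ω) (X : Ω → S)
    {ω : Ω} (hω : 0 < p ω) : 0 < pmfOf p X (X ω) :=
  Finset.sum_pos' (fun ω _ => by split_ifs <;> simp [hp]) ⟨ω, Finset.mem_univ _, by simpa⟩

theorem sum_pmfOf {Ω S : Type*} [Fintype Ω] [Fintype S] (p : Ω → ℝ) (X : Ω → S) :
    ∑ s, pmfOf p X s = ∑ ω, p ω := by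
  simpa using sum_pmfOf_mul p X fun _ => 1

/-- Marginalising the first coordinate of a pair. -/
theorem sum_pmfOf_prodMk {Ω S U : Type*} [Fintype Ω] [Fintype S] (p : Ω → ℝ) (X : Ω → S)
    (Z : Ω → U) (z : U) : ∑ x, pmfOf p (fun ω => (X ω, Z ω)) (x, z) = pmfOf p Z z := by
  classical
  simp only [pmfOf, Prod.mk.injEq]
  rw [Finset.sum_comm]
  refine Finset.sum_congr rfl fun ω _ => ?_
  rw [Finset.sum_eq_single (X ω)]
  · simp
  · intro s _ hs
    rw [if_neg fun h => hs h.1.symm]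
  · simp

theorem Hent_eq_sum {Ω S : Type*} [Fintype Ω] [Fintype S] (p : Ω → ℝ) (X : Ω → S) :
    Hent p X = -∑ ω, p ω * Real.log (pmfOf p X (X ω)) := by
  rw [Hent, sum_pmfOf_mul p X fun s => Real.log (pmfOf p X s)]

/-- Entropy is invariant under injective relabelling. -/
theorem Hent_comp_of_injective {Ω S S' : Type*} [Fintype Ω] [Fintype S] [Fintype S']
    (p : Ω → ℝ) (X : Ω → S) {e : S → S'} (he : Function.Injective e) :
    Hent p (fun ω => e (X ω)) = Hent p X := by
  classical
  have h : ∀ ω, pmfOf p (fun ω => e (X ω)) (e (X ω)) = pmfOf p X (X ω) := fun ω =>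
    Finset.sum_congr rfl fun _ _ => if_congr he.eq_iff rfl rfl
  simp only [Hent_eq_sum, h]

theorem CMI_eq_sum {Ω S T U : Type*} [Fintype Ω] [Fintype S] [Fintype T] [Fintype U]
    (p : Ω → ℝ) (X : Ω → S) (Y : Ω → T) (Z : Ω → U) :
    CMI p X Y Z = ∑ ω, p ω *
      (Real.log (pmfOf p (fun ω => (X ω, Y ω, Z ω)) (X ω, Y ω, Z ω))
        + Real.log (pmfOf p Z (Z ω))
        - Real.log (pmfOf p (fun ω => (X ω, Z ω)) (X ω, Z ω))
        - Real.log (pmfOf p (fun ω => (Y ω, Z ω)) (Y ω, Z ω))) := by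
  simp only [CMI, Hent_eq_sum, mul_sub, mul_add, Finset.sum_sub_distrib, Finset.sum_add_distrib]
  ring

/-- Conditional mutual information vanishes under conditional independence. -/
theorem CMI_eq_zero_of_condIndep {Ω S T U : Type*} [Fintype Ω] [Fintype S] [Fintype T]
    [Fintype U] {p : Ω → ℝ} (hp : ∀ ω, 0 ≤ p ω) (X : Ω → S) (Y : Ω → T) (Z : Ω → U)
    (h : ∀ x y z, pmfOf p (fun ω => (X ω, Y ω, Z ω)) (x, y, z) * pmfOf p Z z
      = pmfOf p (fun ω => (X ω, Z ω)) (x, z) * pmfOf p (fun ω => (Y ω, Z ω)) (y, z)) :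
    CMI p X Y Z = 0 := by
  rw [CMI_eq_sum]
  refine Finset.sum_eq_zero fun ω _ => ?_
  rcases (hp ω).eq_or_lt with h0 | hω
  · simp [← h0]
  have hxyz := pmfOf_apply_pos hp (fun ω => (X ω, Y ω, Z ω)) hω
  have hxz := pmfOf_apply_pos hp (fun ω => (X ω, Z ω)) hω
  have hyz := pmfOf_apply_pos hp (fun ω => (Y ω, Z ω)) hω
  have hz := pmfOf_apply_pos hp Z hω
  rw [← Real.log_mul hxyz.ne' hz.ne', h, Real.log_mul hxz.ne' hyz.ne']
  ring

/-- Strong subadditivity of entropy. -/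
theorem CMI_nonneg {Ω S T U : Type*} [Fintype Ω] [Fintype S] [Fintype T] [Fintype U]
    {p : Ω → ℝ} (hp : ∀ ω, 0 ≤ p ω) (X : Ω → S) (Y : Ω → T) (Z : Ω → U) :
    0 ≤ CMI p X Y Z := by
  set f := pmfOf p (fun ω => (X ω, Y ω, Z ω)) with hf
  set a := pmfOf p (fun ω => (X ω, Z ω)) with ha
  set b := pmfOf p (fun ω => (Y ω, Z ω)) with hb
  set c := pmfOf p Z with hc
  have ha0 : ∀ s, 0 ≤ a s := pmfOf_nonneg hp _
  have hb0 : ∀ s, 0 ≤ b s := pmfOf_nonneg hp _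
  have hc0 : ∀ s, 0 ≤ c s := pmfOf_nonneg hp _
  have hf0 : ∀ s, 0 ≤ f s := pmfOf_nonneg hp _
  have hratio : ∑ ω, p ω * (a (X ω, Z ω) * b (Y ω, Z ω) / (f (X ω, Y ω, Z ω) * c (Z ω)))
      ≤ ∑ ω, p ω := by
    calc ∑ ω, p ω * (a (X ω, Z ω) * b (Y ω, Z ω) / (f (X ω, Y ω, Z ω) * c (Z ω)))
        = ∑ s : S × T × U, f s * (a (s.1, s.2.2) * b s.2 / (f s * c s.2.2)) :=
          (sum_pmfOf_mul p (fun ω => (X ω, Y ω, Z ω))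
            fun s => a (s.1, s.2.2) * b s.2 / (f s * c s.2.2)).symm
      _ ≤ ∑ s : S × T × U, a (s.1, s.2.2) * b s.2 / c s.2.2 := by
          refine Finset.sum_le_sum fun s _ => ?_
          rcases (hf0 s).eq_or_lt with h0 | h0
          · rw [← h0, zero_mul]
            exact div_nonneg (mul_nonneg (ha0 _) (hb0 _)) (hc0 _)
          · rw [mul_div_assoc', mul_div_mul_left _ _ h0.ne']
      _ = ∑ s : T × U, b s := by
          rw [Fintype.sum_prod_type_right]
          refine Finset.sum_congr rfl fun s _ => ?_
          simp only [mul_div_assoc]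
          rw [← Finset.sum_mul, ha, sum_pmfOf_prodMk p X Z s.2, ← hc]
          rcases (hc0 s.2).eq_or_lt with h0 | h0
          · have hle : b s ≤ c s.2 := by
              rw [hc, ← sum_pmfOf_prodMk p Y Z s.2]
              exact Finset.single_le_sum (f := fun y => b (y, s.2)) (fun _ _ => hb0 _)
                (Finset.mem_univ s.1)
            have : b s = 0 := le_antisymm (h0 ▸ hle) (hb0 s)
            simp [this]
          · field_simp
      _ = ∑ ω, p ω := sum_pmfOf p _
  have hterm : ∀ ω, p ω - p ω * (a (X ω, Z ω) * b (Y ω, Z ω) / (f (X ω, Y ω, Z ω) * c (Z ω)))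
      ≤ p ω * (Real.log (f (X ω, Y ω, Z ω)) + Real.log (c (Z ω))
        - Real.log (a (X ω, Z ω)) - Real.log (b (Y ω, Z ω))) := by
    intro ω
    rcases (hp ω).eq_or_lt with h0 | hω
    · simp [← h0]
    have hxyz : 0 < f (X ω, Y ω, Z ω) := pmfOf_apply_pos hp (fun ω => (X ω, Y ω, Z ω)) hω
    have hxz : 0 < a (X ω, Z ω) := pmfOf_apply_pos hp (fun ω => (X ω, Z ω)) hω
    have hyz : 0 < b (Y ω, Z ω) := pmfOf_apply_pos hp (fun ω => (Y ω, Z ω)) hω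
    have hz : 0 < c (Z ω) := pmfOf_apply_pos hp Z hω
    have hlog := Real.log_le_sub_one_of_pos (div_pos (mul_pos hxz hyz) (mul_pos hxyz hz))
    rw [Real.log_div (mul_pos hxz hyz).ne' (mul_pos hxyz hz).ne',
      Real.log_mul hxz.ne' hyz.ne', Real.log_mul hxyz.ne' hz.ne'] at hlog
    rw [← mul_one_sub]
    exact mul_le_mul_of_nonneg_left (by linarith) hω.le
  rw [CMI_eq_sum]
  have := Finset.sum_le_sum fun ω (_ : ω ∈ Finset.univ) => hterm ω
  rw [Finset.sum_sub_distrib] at this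
  linarith

/-- Chain-rule comparison: if `I(X ; W ∣ Z) = 0`, conditioning further on `W` cannot decrease
`I(X ; Y ∣ Z)`. -/
theorem CMI_le_CMI_of_CMI_eq_zero {Ω S T U V : Type*} [Fintype Ω] [Fintype S] [Fintype T]
    [Fintype U] [Fintype V] {p : Ω → ℝ} (hp : ∀ ω, 0 ≤ p ω) (X : Ω → S) (Y : Ω → T)
    (W : Ω → V) (Z : Ω → U) (h : CMI p X W Z = 0) :
    CMI p X Y Z ≤ CMI p X Y (fun ω => (W ω, Z ω)) := by
  have hnn := CMI_nonneg hp X W (fun ω => (Y ω, Z ω))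
  have h1 : Hent p (fun ω => (Y ω, W ω, Z ω)) = Hent p (fun ω => (W ω, Y ω, Z ω)) :=
    Hent_comp_of_injective p (fun ω => (W ω, Y ω, Z ω)) (e := fun s => (s.2.1, s.1, s.2.2))
      (by rintro ⟨_, _, _⟩ ⟨_, _, _⟩ h; simp_all)
  have h2 : Hent p (fun ω => (X ω, Y ω, W ω, Z ω)) = Hent p (fun ω => (X ω, W ω, Y ω, Z ω)) :=
    Hent_comp_of_injective p (fun ω => (X ω, W ω, Y ω, Z ω))
      (e := fun s => (s.1, s.2.2.1, s.2.1, s.2.2.2))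
      (by rintro ⟨_, _, _, _⟩ ⟨_, _, _, _⟩ h; simp_all)
  simp only [CMI] at h hnn ⊢
  linarith

open scoped Classical in
/-- Joint law of `Y0` and a subfamily of the components of `B`, under full independence. The
variable `X` encodes `Y0` together with the components indexed by `J`. -/
theorem pmfOf_eq_mul_prod_of_indep {Ω M BT ι S : Type*} [Fintype Ω] [Fintype BT] [Fintype ι]
    (p : Ω → ℝ) (hp1 : ∑ ω, p ω = 1) (Y0 : Ω → M) (B : Ω → ι → BT)
    (hind : ∀ (y : M) (b : ι → BT),
      pmfOf p (fun ω => (Y0 ω, B ω)) (y, b)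
        = pmfOf p Y0 y * ∏ i, pmfOf p (fun ω => B ω i) (b i))
    (J : Finset ι) (y : M) (c : ι → BT) (X : Ω → S) (s : S)
    (hX : ∀ ω, X ω = s ↔ Y0 ω = y ∧ ∀ i ∈ J, B ω i = c i) :
    pmfOf p X s = pmfOf p Y0 y * ∏ i ∈ J, pmfOf p (fun ω => B ω i) (c i) := by
  have hmarg : ∀ i, (∑ β, if i ∈ J → β = c i then pmfOf p (fun ω => B ω i) β else 0)
      = if i ∈ J then pmfOf p (fun ω => B ω i) (c i) else 1 := by
    intro i
    by_cases hi : i ∈ J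
    · simp [hi]
    · simp [hi, sum_pmfOf, hp1]
  calc pmfOf p X s
      = ∑ ω, if Y0 ω = y ∧ ∀ i ∈ J, B ω i = c i then p ω else 0 :=
        Finset.sum_congr rfl fun ω _ => if_congr (hX ω) rfl rfl
    _ = ∑ b : ι → BT, if ∀ i ∈ J, b i = c i then pmfOf p (fun ω => (Y0 ω, B ω)) (y, b)
          else 0 := by
        simp only [pmfOf, ← Finset.sum_filter (s := (Finset.univ : Finset (ι → BT)))]
        rw [Finset.sum_comm]
        refine Finset.sum_congr rfl fun ω _ => ?_
        rw [Finset.sum_filter, Finset.sum_eq_single (B ω)]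
        · by_cases h1 : Y0 ω = y <;> simp [h1]
        · intro b _ hb
          have : ¬ (Y0 ω, B ω) = (y, b) := fun h => hb (Prod.ext_iff.1 h).2.symm
          simp [this]
        · simp
    _ = pmfOf p Y0 y * ∑ b : ι → BT, ∏ i,
          if i ∈ J → b i = c i then pmfOf p (fun ω => B ω i) (b i) else 0 := by
        rw [Finset.mul_sum]
        refine Finset.sum_congr rfl fun b _ => ?_
        rw [hind]
        by_cases hb : ∀ i ∈ J, b i = c i
        · rw [if_pos hb]
          congr 1
          exact Finset.prod_congr rfl fun i _ => (if_pos (hb i)).symm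
        · rw [if_neg hb]
          push Not at hb
          obtain ⟨i, hi, hne⟩ := hb
          rw [Finset.prod_eq_zero (Finset.mem_univ i) (by simp [hi, hne]), mul_zero]
    _ = pmfOf p Y0 y * ∏ i ∈ J, pmfOf p (fun ω => B ω i) (c i) := by
        rw [← Fintype.prod_sum (fun i β =>
          if i ∈ J → β = c i then pmfOf p (fun ω => B ω i) β else 0)]
        simp only [hmarg]
        rw [Finset.prod_ite_mem, Finset.univ_inter]

/-- Conditioning on additional independent shared-randomness components cannot decrease
conditional mutual information: for `B = (B₁,…,B_{N_B})` with mutually independent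
components, jointly independent of `Y₀`, and pairwise disjoint `J₁, J₂, J₃ ⊆ [N_B]`,
`I(B_{J₁}; Y ∣ Y₀, B_{J₃}) ≤ I(B_{J₁}; Y ∣ B_{J₂}, Y₀, B_{J₃})`. -/
theorem cmi_le_cmi_extra_conditioning
    {Ω M T BT : Type*} [Fintype Ω] [Fintype M] [Fintype T] [Fintype BT] {NB : ℕ}
    (p : Ω → ℝ) (hp0 : ∀ ω, 0 ≤ p ω) (hp1 : ∑ ω, p ω = 1)
    (Y0 : Ω → M) (Y : Ω → T) (B : Ω → Fin NB → BT)
    (hind : ∀ (y : M) (b : Fin NB → BT),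
      pmfOf p (fun ω => (Y0 ω, B ω)) (y, b)
        = pmfOf p Y0 y * ∏ i : Fin NB, pmfOf p (fun ω => B ω i) (b i))
    (J1 J2 J3 : Finset (Fin NB))
    (h12 : Disjoint J1 J2) (h13 : Disjoint J1 J3) (h23 : Disjoint J2 J3) :
    CMI p (fun ω => fun i : ↥J1 => B ω i) Y (fun ω => (Y0 ω, fun i : ↥J3 => B ω i))
      ≤ CMI p (fun ω => fun i : ↥J1 => B ω i) Y
          (fun ω => ((fun i : ↥J2 => B ω i), Y0 ω, fun i : ↥J3 => B ω i)) := by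
  classical
  refine CMI_le_CMI_of_CMI_eq_zero hp0 _ Y (fun ω => fun i : ↥J2 => B ω i)
    (fun ω => (Y0 ω, fun i : ↥J3 => B ω i)) (CMI_eq_zero_of_condIndep hp0 _ _ _ ?_)
  rintro x w ⟨y, z⟩
  obtain ⟨ω₀⟩ : Nonempty Ω := by
    by_contra hne
    rw [not_nonempty_iff] at hne
    simp at hp1
  obtain ⟨c, hx, hw, hz⟩ : ∃ c : Fin NB → BT, (∀ i : ↥J1, x i = c i) ∧
      (∀ i : ↥J2, w i = c i) ∧ ∀ i : ↥J3, z i = c i := by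
    refine ⟨fun i => if h1 : i ∈ J1 then x ⟨i, h1⟩ else if h2 : i ∈ J2 then w ⟨i, h2⟩
      else if h3 : i ∈ J3 then z ⟨i, h3⟩ else B ω₀ i, fun i => ?_, fun i => ?_, fun i => ?_⟩
    · simp
    · simp [Finset.disjoint_right.1 h12 i.2]
    · simp [Finset.disjoint_right.1 h13 i.2, Finset.disjoint_right.1 h23 i.2]
  rw [pmfOf_eq_mul_prod_of_indep p hp1 Y0 B hind (J1 ∪ (J2 ∪ J3)) y c
      (fun ω => ((fun i : ↥J1 => B ω i), (fun i : ↥J2 => B ω i), Y0 ω, fun i : ↥J3 => B ω i)),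
    pmfOf_eq_mul_prod_of_indep p hp1 Y0 B hind (J1 ∪ J3) y c
      (fun ω => ((fun i : ↥J1 => B ω i), Y0 ω, fun i : ↥J3 => B ω i)),
    pmfOf_eq_mul_prod_of_indep p hp1 Y0 B hind (J2 ∪ J3) y c
      (fun ω => ((fun i : ↥J2 => B ω i), Y0 ω, fun i : ↥J3 => B ω i)),
    pmfOf_eq_mul_prod_of_indep p hp1 Y0 B hind J3 y c
      (fun ω => (Y0 ω, fun i : ↥J3 => B ω i)),
    Finset.prod_union (Finset.disjoint_union_right.2 ⟨h12, h13⟩),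
    Finset.prod_union h23, Finset.prod_union h13]
  · ring
  all_goals
    intro ω
    simp only [Prod.mk.injEq, funext_iff, hx, hw, hz, Subtype.forall, Finset.mem_union] <;> grind
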